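/- In the rounding process with LP-feasible x, for every time t and all bins i ≠ j, Cov(1_{O^E_{i,t}}, 1_{O^E_{j,t}}) ≤ 0. -/

import Mathlib

open Finset

noncomputable section
open scoped Classical

namespace Rounding

/-- A configuration of all the randomness used by the rounding process: arrival
indicators `A_t`, first picks `I¹_t`, second picks `I²_t`, and acceptance coins
`Y_{i,t}`. -/
abbrev Cfg (m n : ℕ) :=
  (Fin n → Bool) × (Fin n → Fin m) × (Fin n → Fin m) × (Fin m → Fin n → Bool)

/-- The constant `c = 1/100`. -/
def c : ℝ := 1 / 100

variable (m n : ℕ)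

/-- `S x i t = ∑_{t' < t} x i t'`. -/
def S (x : Fin m → Fin n → ℝ) (i : Fin m) (t : Fin n) : ℝ :=
  ∑ t' ∈ Finset.univ.filter fun t' : Fin n => t' < t, x i t'

/-- LP-feasibility of `x` (with arrival probabilities `p t ∈ (0,1]`, every
constraint `∑_i x i t = p t` tight). -/
def LPFeasible (p : Fin n → ℝ) (x : Fin m → Fin n → ℝ) : Prop :=
  (∀ t, 0 < p t ∧ p t ≤ 1) ∧
  (∀ i t, 0 ≤ x i t) ∧
  (∀ i, ∑ t, x i t ≤ 1) ∧
  (∀ t, ∑ i, x i t = p t) ∧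
  (∀ i t, x i t ≤ p t * (1 - S m n x i t))

/-- Edge `(i,t)` is early if `∑_{t' < t} x i t' ≤ (1/2 − c)/(1/2 + c)`. -/
def Early (x : Fin m → Fin n → ℝ) (i : Fin m) (t : Fin n) : Prop :=
  S m n x i t ≤ (1/2 - c) / (1/2 + c)

/-- Edge `(i,t)` is late if it is not early. -/
def Late (x : Fin m → Fin n → ℝ) (i : Fin m) (t : Fin n) : Prop :=
  ¬ Early m n x i t

/-- The acceptance probability `q_{i,t}`. -/
def q (x : Fin m → Fin n → ℝ) (i : Fin m) (t : Fin n) : ℝ :=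
  min 1 ((1/2 + c) / (1 - (1/2 + c) * S m n x i t))

/-- The probability of a configuration: the product of the probabilities of all
the mutually independent components (`P(A_t = 1) = p_t`,
`P(I¹_t = i) = P(I²_t = i) = x_{i,t}/p_t`, `P(Y_{i,t} = 1) = q_{i,t}`). -/
def weight (p : Fin n → ℝ) (x : Fin m → Fin n → ℝ) (cfg : Cfg m n) : ℝ :=
  (∏ t, if cfg.1 t then p t else 1 - p t) *
  (∏ t, x (cfg.2.1 t) t / p t) *
  (∏ t, x (cfg.2.2.1 t) t / p t) *
  ∏ i, ∏ t, if cfg.2.2.2 i t then q m n x i t else 1 - q m n x i t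

/-- Probability of an event. -/
def Pr (p : Fin n → ℝ) (x : Fin m → Fin n → ℝ) (E : Set (Cfg m n)) : ℝ :=
  ∑ cfg : Cfg m n, if cfg ∈ E then weight m n p x cfg else 0

/-- Conditional probability of `E` given `F`. -/
def condPr (p : Fin n → ℝ) (x : Fin m → Fin n → ℝ) (E F : Set (Cfg m n)) : ℝ :=
  Pr m n p x (E ∩ F) / Pr m n p x F

/-- Bin `i` is unmatched in the partial matching `M`. -/
def FreeBin (M : Finset (Fin m × Fin n)) (i : Fin m) : Prop :=
  ∀ t, (i, t) ∉ M

/-- `proc x cfg t = (M₁, M₂)`: the two parts of the matching built by the rounding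
process after processing all times `< t`.  At each time `t`, if ball `t` arrives,
its first pick `I¹_t` is unmatched, and the coin `Y_{I¹_t,t}` comes up heads, then
`(I¹_t, t)` is added to `M₁`; otherwise, if ball `t` arrives, its second pick
`I²_t` is unmatched, and edge `(I²_t, t)` is late, then `(I²_t, t)` is added
to `M₂`. -/
def proc (x : Fin m → Fin n → ℝ) (cfg : Cfg m n) :
    ℕ → Finset (Fin m × Fin n) × Finset (Fin m × Fin n)
  | 0 => (∅, ∅)
  | (t + 1) =>
    let P := proc x cfg t
    if h : t < n then
      let T : Fin n := ⟨t, h⟩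
      let M := P.1 ∪ P.2
      if cfg.1 T = true ∧ FreeBin m n M (cfg.2.1 T) ∧ cfg.2.2.2 (cfg.2.1 T) T = true then
        (insert (cfg.2.1 T, T) P.1, P.2)
      else if cfg.1 T = true ∧ FreeBin m n M (cfg.2.2.1 T) ∧ Late m n x (cfg.2.2.1 T) T then
        (P.1, insert (cfg.2.2.1 T, T) P.2)
      else P
    else P

/-- The final matching `M₁` (edges matched on a first pick). -/
def M1F (x : Fin m → Fin n → ℝ) (cfg : Cfg m n) : Finset (Fin m × Fin n) :=
  (proc m n x cfg n).1

/-- The final matching `M₂` (edges matched on a second pick). -/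
def M2F (x : Fin m → Fin n → ℝ) (cfg : Cfg m n) : Finset (Fin m × Fin n) :=
  (proc m n x cfg n).2

/-- The final matching `M = M₁ ∪ M₂`. -/
def MF (x : Fin m → Fin n → ℝ) (cfg : Cfg m n) : Finset (Fin m × Fin n) :=
  M1F m n x cfg ∪ M2F m n x cfg

/-- `V_{i,t}`: the event that bin `i` is unmatched before time `t`. -/
def V (x : Fin m → Fin n → ℝ) (i : Fin m) (t : Fin n) : Set (Cfg m n) :=
  {cfg | FreeBin m n ((proc m n x cfg t.1).1 ∪ (proc m n x cfg t.1).2) i}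

/-- `O_{i,t}`: the event that bin `i` is matched before time `t`. -/
def O (x : Fin m → Fin n → ℝ) (i : Fin m) (t : Fin n) : Set (Cfg m n) :=
  (V m n x i t)ᶜ

/-- `O^E_{i,t}`: the event that bin `i` is matched along an early edge before time `t`. -/
def OE (x : Fin m → Fin n → ℝ) (i : Fin m) (t : Fin n) : Set (Cfg m n) :=
  {cfg | ∃ t' : Fin n, Early m n x i t' ∧
    (i, t') ∈ (proc m n x cfg t.1).1 ∪ (proc m n x cfg t.1).2}

/-- `O^L_{i,t}`: the event that bin `i` is matched along a late edge before time `t`. -/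
def OL (x : Fin m → Fin n → ℝ) (i : Fin m) (t : Fin n) : Set (Cfg m n) :=
  {cfg | ∃ t' : Fin n, Late m n x i t' ∧
    (i, t') ∈ (proc m n x cfg t.1).1 ∪ (proc m n x cfg t.1).2}

/-- `U₁(t)`: the event that ball `t` is not matched in the first-pick step at time `t`. -/
def U1 (x : Fin m → Fin n → ℝ) (t : Fin n) : Set (Cfg m n) :=
  {cfg | ∀ i, (i, t) ∉ (proc m n x cfg (t.1 + 1)).1}

/-- The event that ball `t` arrives (`A_t = 1`). -/
def EvA (t : Fin n) : Set (Cfg m n) := {cfg | cfg.1 t = true}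

/-- The event that the first pick of ball `t` is bin `j` (`I¹_t = j`). -/
def EvI1 (j : Fin m) (t : Fin n) : Set (Cfg m n) := {cfg | cfg.2.1 t = j}


section

/-- The randomness used by a single ball: its arrival, its two picks and its coins. -/
abbrev Loc (m : ℕ) := Bool × Fin m × Fin m × (Fin m → Bool)

/-- A configuration is a family of independent single-ball configurations. -/
def cfgEquiv : Cfg m n ≃ (Fin n → Loc m) where
  toFun cfg s := (cfg.1 s, cfg.2.1 s, cfg.2.2.1 s, fun i => cfg.2.2.2 i s)
  invFun f := (fun s => (f s).1, fun s => (f s).2.1, fun s => (f s).2.2.1,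
    fun i s => (f s).2.2.2 i)
  left_inv _ := rfl
  right_inv _ := rfl

/-- The probability of a single-ball configuration. -/
def locWeight (p : Fin n → ℝ) (x : Fin m → Fin n → ℝ) (s : Fin n) (w : Loc m) : ℝ :=
  (if w.1 then p s else 1 - p s) * (x w.2.1 s / p s) * (x w.2.2.1 s / p s) *
    ∏ i, if w.2.2.2 i then q m n x i s else 1 - q m n x i s

/-- Probability of a single-ball event. -/
def locPr (p : Fin n → ℝ) (x : Fin m → Fin n → ℝ) (s : Fin n) (G : Set (Loc m)) : ℝ :=
  ∑ w : Loc m, if w ∈ G then locWeight m n p x s w else 0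

/-- The event that ball `s` proposes to bin `i` with its first pick along an early edge,
before time `t`. -/
def earlyHit (x : Fin m → Fin n → ℝ) (t : Fin n) (i : Fin m) (s : Fin n) : Set (Loc m) :=
  {w | s < t ∧ Early m n x i s ∧ w.1 = true ∧ w.2.1 = i ∧ w.2.2.2 i = true}

variable {m n}
variable {p : Fin n → ℝ} {x : Fin m → Fin n → ℝ}

lemma weight_eq_prod (cfg : Cfg m n) :
    weight m n p x cfg = ∏ s, locWeight m n p x s (cfgEquiv m n cfg s) := by
  simp only [weight, locWeight, cfgEquiv, Equiv.coe_fn_mk, Finset.prod_mul_distrib]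
  congr 1
  exact Finset.prod_comm

/-- Independence of the balls. -/
lemma Pr_forall_eq_prod (G : Fin n → Set (Loc m)) :
    Pr m n p x {cfg | ∀ s, cfgEquiv m n cfg s ∈ G s} = ∏ s, locPr m n p x s (G s) := by
  unfold Pr locPr
  rw [Fintype.prod_sum, ← (cfgEquiv m n).sum_comp]
  refine Finset.sum_congr rfl fun cfg _ => ?_
  rw [Finset.prod_ite_zero, weight_eq_prod]
  simp

lemma S_le_one (hx : LPFeasible m n p x) (i : Fin m) (s : Fin n) : S m n x i s ≤ 1 :=
  (Finset.sum_le_univ_sum_of_nonneg (hx.2.1 i)).trans (hx.2.2.1 i)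

lemma Early.mono (hx : LPFeasible m n p x) {i : Fin m} {s t : Fin n} (hst : s ≤ t)
    (ht : Early m n x i t) : Early m n x i s := by
  refine le_trans (Finset.sum_le_sum_of_subset_of_nonneg ?_ fun k _ _ => hx.2.1 i k) ht
  intro k hk
  simp only [Finset.mem_filter, Finset.mem_univ, true_and] at hk ⊢
  exact hk.trans_le hst

lemma q_nonneg (hx : LPFeasible m n p x) (i : Fin m) (s : Fin n) : 0 ≤ q m n x i s := by
  have h := S_le_one hx i s
  refine le_min zero_le_one (div_nonneg ?_ ?_) <;> norm_num [c]
  linarith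

lemma locWeight_nonneg (hx : LPFeasible m n p x) (s : Fin n) (w : Loc m) :
    0 ≤ locWeight m n p x s w := by
  have hp := hx.1 s
  refine mul_nonneg (mul_nonneg (mul_nonneg ?_ ?_) ?_) (Finset.prod_nonneg fun i _ => ?_)
  · split_ifs <;> linarith
  · exact div_nonneg (hx.2.1 _ _) hp.1.le
  · exact div_nonneg (hx.2.1 _ _) hp.1.le
  · have h1 := q_nonneg hx i s
    have h2 : q m n x i s ≤ 1 := min_le_left _ _
    split_ifs <;> linarith

lemma locPr_nonneg (hx : LPFeasible m n p x) (s : Fin n) (G : Set (Loc m)) :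
    0 ≤ locPr m n p x s G :=
  Finset.sum_nonneg fun w _ => by
    split_ifs
    exacts [locWeight_nonneg hx s w, le_rfl]

lemma locPr_univ (hx : LPFeasible m n p x) (s : Fin n) :
    locPr m n p x s Set.univ = 1 := by
  have hpick : ∑ i, x i s / p s = 1 := by
    rw [← Finset.sum_div, hx.2.2.2.1 s, div_self (hx.1 s).1.ne']
  have hcoin : ∑ b : Fin m → Bool, ∏ i, (if b i then q m n x i s else 1 - q m n x i s) = 1 := by
    rw [← Fintype.prod_sum fun i (b : Bool) => if b then q m n x i s else 1 - q m n x i s]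
    simp
  simp only [locPr, locWeight, Set.mem_univ, if_true, Fintype.sum_prod_type]
  have hsum (a : ℝ) : ∑ i, ∑ j, ∑ b : Fin m → Bool, a * (x i s / p s) * (x j s / p s) *
      ∏ k, (if b k then q m n x k s else 1 - q m n x k s) = a := by
    calc _ = a * ∑ i, x i s / p s * ∑ j, x j s / p s *
          ∑ b : Fin m → Bool, ∏ k, (if b k then q m n x k s else 1 - q m n x k s) := by
          simp only [Finset.mul_sum, mul_assoc]
      _ = a := by simp only [hcoin, hpick, mul_one]
  simp [hsum]

lemma locPr_compl (hx : LPFeasible m n p x) (s : Fin n) (G : Set (Loc m)) :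
    locPr m n p x s Gᶜ = 1 - locPr m n p x s G := by
  rw [← locPr_univ hx s]
  simp only [locPr, ← Finset.sum_sub_distrib]
  refine Finset.sum_congr rfl fun w _ => ?_
  by_cases h : w ∈ G <;> simp [h]

lemma locPr_union {G H : Set (Loc m)} (hGH : Disjoint G H) (s : Fin n) :
    locPr m n p x s (G ∪ H) = locPr m n p x s G + locPr m n p x s H := by
  simp only [locPr, ← Finset.sum_add_distrib]
  refine Finset.sum_congr rfl fun w _ => ?_
  by_cases h : w ∈ G
  · simp [h, hGH.notMem_of_mem_left h]
  · simp [h]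

/-- Avoiding each of two disjoint events are negatively correlated. -/
lemma locPr_compl_inter_compl_le (hx : LPFeasible m n p x) (s : Fin n) {G H : Set (Loc m)}
    (hGH : Disjoint G H) :
    locPr m n p x s (Gᶜ ∩ Hᶜ) ≤ locPr m n p x s Gᶜ * locPr m n p x s Hᶜ := by
  rw [← Set.compl_union, locPr_compl hx, locPr_compl hx, locPr_compl hx, locPr_union hGH]
  nlinarith [mul_nonneg (locPr_nonneg hx s G) (locPr_nonneg hx s H)]

lemma Pr_univ (hx : LPFeasible m n p x) : Pr m n p x Set.univ = 1 := by
  simpa [locPr_univ hx] using Pr_forall_eq_prod (p := p) (x := x) (fun _ => Set.univ)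

lemma cov_eq_cov_compl (hx : LPFeasible m n p x) (E F : Set (Cfg m n)) :
    Pr m n p x (E ∩ F) - Pr m n p x E * Pr m n p x F =
      Pr m n p x (Eᶜ ∩ Fᶜ) - Pr m n p x Eᶜ * Pr m n p x Fᶜ := by
  have hcompl (G : Set (Cfg m n)) : Pr m n p x Gᶜ = 1 - Pr m n p x G := by
    rw [← Pr_univ hx]
    simp only [Pr, ← Finset.sum_sub_distrib]
    refine Finset.sum_congr rfl fun w _ => ?_
    by_cases h : w ∈ G <;> simp [h]
  have hunion : Pr m n p x (E ∪ F) = Pr m n p x E + Pr m n p x F - Pr m n p x (E ∩ F) := by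
    simp only [Pr, ← Finset.sum_add_distrib, ← Finset.sum_sub_distrib]
    refine Finset.sum_congr rfl fun w _ => ?_
    by_cases h : w ∈ E <;> by_cases h' : w ∈ F <;> simp [h, h']
  rw [← Set.compl_union, hcompl, hcompl, hcompl, hunion]
  ring

lemma lt_of_mem_proc (cfg : Cfg m n) (k : ℕ) (e : Fin m × Fin n)
    (he : e ∈ (proc m n x cfg k).1 ∪ (proc m n x cfg k).2) : e.2.1 < k := by
  induction k with
  | zero => simp [proc] at he
  | succ k ih =>
    rw [Finset.mem_union] at he ih
    simp only [proc] at he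
    split_ifs at he <;> grind

/-- A bin is matched along an early edge before time `k` iff some early ball before time `k`
successfully proposes to it with its first pick. -/
lemma exists_early_mem_proc_iff (hx : LPFeasible m n p x) (cfg : Cfg m n) (i : Fin m) (k : ℕ) :
    (∃ s, Early m n x i s ∧ (i, s) ∈ (proc m n x cfg k).1 ∪ (proc m n x cfg k).2) ↔
      ∃ s : Fin n, s.1 < k ∧ Early m n x i s ∧
        cfg.1 s = true ∧ cfg.2.1 s = i ∧ cfg.2.2.2 i s = true := by
  induction k with
  | zero => simp [proc]
  | succ k ih =>
    have hlt := lt_of_mem_proc (x := x) cfg k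
    have hfree : ∀ h : k < n, Early m n x i ⟨k, h⟩ →
        ¬ FreeBin m n ((proc m n x cfg k).1 ∪ (proc m n x cfg k).2) i →
        ∃ s, Early m n x i s ∧ (i, s) ∈ (proc m n x cfg k).1 ∪ (proc m n x cfg k).2 := by
      intro h hE hF
      simp only [FreeBin, not_forall, not_not] at hF
      obtain ⟨s, hs⟩ := hF
      exact ⟨s, hE.mono hx (hlt _ hs).le, hs⟩
    have hmono : ∀ e ∈ (proc m n x cfg k).1 ∪ (proc m n x cfg k).2,
        e ∈ (proc m n x cfg (k + 1)).1 ∪ (proc m n x cfg (k + 1)).2 := by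
      intro e he
      simp only [proc]
      split_ifs <;> grind
    constructor
    · rintro ⟨s, hE, hs⟩
      by_cases hs' : (i, s) ∈ (proc m n x cfg k).1 ∪ (proc m n x cfg k).2
      · obtain ⟨r, hr, h⟩ := ih.1 ⟨s, hE, hs'⟩
        exact ⟨r, hr.trans k.lt_succ_self, h⟩
      · simp only [proc] at hs
        split_ifs at hs with h1 h2 h3 <;> grind [Late]
    · rintro ⟨s, hs, hE, hA, hI, hY⟩
      suffices h : (∃ s, Early m n x i s ∧
          (i, s) ∈ (proc m n x cfg k).1 ∪ (proc m n x cfg k).2) ∨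
          (i, s) ∈ (proc m n x cfg (k + 1)).1 ∪ (proc m n x cfg (k + 1)).2 by
        rcases h with ⟨r, hr, h⟩ | h
        exacts [⟨r, hr, hmono _ h⟩, ⟨s, hE, h⟩]
      rcases Nat.lt_succ_iff_lt_or_eq.1 hs with hsk | rfl
      · exact Or.inl (ih.2 ⟨s, hsk, hE, hA, hI, hY⟩)
      · by_cases hF : FreeBin m n ((proc m n x cfg s).1 ∪ (proc m n x cfg s).2) i
        · right
          simp [proc, hA, hI, hY, hF]
        · exact Or.inl (hfree s.2 hE hF)

lemma compl_OE_eq (hx : LPFeasible m n p x) (t : Fin n) (i : Fin m) :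
    (OE m n x i t)ᶜ = {cfg | ∀ s, cfgEquiv m n cfg s ∈ (earlyHit m n x t i s)ᶜ} := by
  ext cfg
  rw [Set.mem_compl_iff, OE, Set.mem_ofPred_eq, exists_early_mem_proc_iff hx, not_exists]
  rfl

end

/-- in the rounding process with LP-feasible `x`, for every time `t` and
bins `i ≠ j`, `Cov(1_{O^E_{i,t}}, 1_{O^E_{j,t}}) =
P[O^E_{i,t} ∩ O^E_{j,t}] − P[O^E_{i,t}]·P[O^E_{j,t}] ≤ 0`. -/
theorem OE_neg_corr (p : Fin n → ℝ) (x : Fin m → Fin n → ℝ)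
    (hx : LPFeasible m n p x) (t : Fin n) (i j : Fin m) (hij : i ≠ j) :
    Pr m n p x (OE m n x i t ∩ OE m n x j t) -
      Pr m n p x (OE m n x i t) * Pr m n p x (OE m n x j t) ≤ 0 := by
  rw [cov_eq_cov_compl hx, sub_nonpos, compl_OE_eq hx, compl_OE_eq hx, ← Set.ofPred_and]
  simp only [← forall_and, ← Set.mem_inter_iff]
  rw [Pr_forall_eq_prod, Pr_forall_eq_prod, Pr_forall_eq_prod, ← Finset.prod_mul_distrib]
  refine Finset.prod_le_prod (fun s _ => locPr_nonneg hx s _) fun s _ =>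
    locPr_compl_inter_compl_le hx s ?_
  rw [Set.disjoint_left]
  rintro w ⟨_, _, _, hi, _⟩ ⟨_, _, _, hj, _⟩
  exact hij (hi.symm.trans hj)

end Rounding
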